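/- An infinite word s over a finite alphabet A is standard episturmian if and only if a·s ≤ min(s) in the lexicographic order for every acceptable pair (a, <) on A. -/

import Mathlib

/-- The prefix of length `k` of an infinite word `t`. -/
def prefixList {A : Type*} (t : ℕ → A) (k : ℕ) : List A := (List.range k).map t

/-- `u` occurs as a factor of the infinite word `t` at position `i`. -/
def FactorAt {A : Type*} (t : ℕ → A) (u : List A) (i : ℕ) : Prop :=
  u = (List.range u.length).map (fun j => t (i + j))

/-- `u` is a (finite) factor of the infinite word `t`. -/
def IsFactorInf {A : Type*} (t : ℕ → A) (u : List A) : Prop := ∃ i, FactorAt t u i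

/-- An infinite word is recurrent if each of its factors occurs infinitely often. -/
def Recurrent {A : Type*} (t : ℕ → A) : Prop :=
  ∀ u, IsFactorInf t u → ∀ N, ∃ i, N ≤ i ∧ FactorAt t u i

/-- `u` is a right special factor of `t`. -/
def RightSpecial {A : Type*} (t : ℕ → A) (u : List A) : Prop :=
  ∃ a b : A, a ≠ b ∧ IsFactorInf t (u ++ [a]) ∧ IsFactorInf t (u ++ [b])

/-- `u` is a left special factor of `t`. -/
def LeftSpecial {A : Type*} (t : ℕ → A) (u : List A) : Prop :=
  ∃ a b : A, a ≠ b ∧ IsFactorInf t (a :: u) ∧ IsFactorInf t (b :: u)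

/-- An infinite word is episturmian if its set of factors is closed under reversal
and it has at most one right special factor of each length. -/
def Episturmian {A : Type*} (t : ℕ → A) : Prop :=
  (∀ u, IsFactorInf t u → IsFactorInf t u.reverse) ∧
  (∀ u v, RightSpecial t u → RightSpecial t v → u.length = v.length → u = v)

/-- A standard episturmian word: episturmian with all left special factors prefixes. -/
def StdEpisturmian {A : Type*} (t : ℕ → A) : Prop :=
  Episturmian t ∧ ∀ u, LeftSpecial t u → u = prefixList t u.length

/-- A finite word is finite episturmian if it is a factor of some episturmian infinite word. -/
def FiniteEpisturmian {A : Type*} (w : List A) : Prop :=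
  ∃ t : ℕ → A, Episturmian t ∧ IsFactorInf t w

/-- An acceptable pair: a strict total order `r` on `A` together with a letter `a`
that is minimal for `r`. -/
def AcceptablePair {A : Type*} (r : A → A → Prop) (a : A) : Prop :=
  IsStrictTotalOrder A r ∧ ∀ b, b ≠ a → r a b

/-- Non-strict lexicographic order on finite words induced by the order `r` on letters. -/
def listLe {A : Type*} (r : A → A → Prop) (u v : List A) : Prop := u = v ∨ List.Lex r u v

/-- Non-strict lexicographic order on infinite words induced by the order `r` on letters. -/
def infLe {A : Type*} (r : A → A → Prop) (x y : ℕ → A) : Prop :=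
  x = y ∨ ∃ i, (∀ j, j < i → x j = y j) ∧ r (x i) (y i)

/-- `m` is the lexicographically smallest factor of the finite word `w` of length `k`. -/
def IsMinFacLen {A : Type*} (r : A → A → Prop) (w : List A) (k : ℕ) (m : List A) : Prop :=
  m <:+: w ∧ m.length = k ∧ ∀ u, u <:+: w → u.length = k → listLe r m u

/-- `m` is the lexicographically greatest factor of the finite word `w` of length `k`. -/
def IsMaxFacLen {A : Type*} (r : A → A → Prop) (w : List A) (k : ℕ) (m : List A) : Prop :=
  m <:+: w ∧ m.length = k ∧ ∀ u, u <:+: w → u.length = k → listLe r u m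

/-- `m = min(w)`: for each `j ≤ |m|` the prefix of `m` of length `j` is `min(w|j)`,
and `|m|` is maximal with this chain property. -/
def IsMinFin {A : Type*} (r : A → A → Prop) (w m : List A) : Prop :=
  m ≠ [] ∧
  (∀ j, j ≤ m.length → IsMinFacLen r w j (m.take j)) ∧
  (∀ m', IsMinFacLen r w (m.length + 1) m' → ¬ m <+: m')

/-- `m = max(w)` (finite word version). -/
def IsMaxFin {A : Type*} (r : A → A → Prop) (w m : List A) : Prop :=
  m ≠ [] ∧
  (∀ j, j ≤ m.length → IsMaxFacLen r w j (m.take j)) ∧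
  (∀ m', IsMaxFacLen r w (m.length + 1) m' → ¬ m <+: m')

/-- `m = min(t)` for an infinite word `t`: each prefix of `m` is the lexicographically
smallest factor of `t` of its length. -/
def IsMinInf {A : Type*} (r : A → A → Prop) (t m : ℕ → A) : Prop :=
  ∀ k, IsFactorInf t (prefixList m k) ∧
    ∀ u, IsFactorInf t u → u.length = k → listLe r (prefixList m k) u

/-- `m = max(t)` for an infinite word `t`. -/
def IsMaxInf {A : Type*} (r : A → A → Prop) (t m : ℕ → A) : Prop :=
  ∀ k, IsFactorInf t (prefixList m k) ∧
    ∀ u, IsFactorInf t u → u.length = k → listLe r u (prefixList m k)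

/-- Prepend a letter to an infinite word. -/
def consInf {A : Type*} (a : A) (t : ℕ → A) : ℕ → A
  | 0 => a
  | n + 1 => t n

/-- Prepend a finite word to an infinite word. -/
def wordAppend {A : Type*} (v : List A) (t : ℕ → A) : ℕ → A :=
  fun n => if h : n < v.length then v.get ⟨n, h⟩ else t (n - v.length)

/-- The pure epistandard morphism `ψ_z` on finite words: it fixes `z` and sends
each letter `x ≠ z` to `zx`. -/
def psiW {A : Type*} [DecidableEq A] (z : A) (w : List A) : List A :=
  (w.map (fun x => if x = z then [z] else [z, x])).flatten

/-- The finite word `u` is a prefix of the infinite word `t`. -/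
def IsPrefixInf {A : Type*} (u : List A) (t : ℕ → A) : Prop := u = prefixList t u.length

/-- `y = f(t)`: the infinite word `y` is the image of the infinite word `t` under the
(non-erasing) morphism `f`, acting letter by letter. -/
def IsMorphImage {A : Type*} (f : List A → List A) (t y : ℕ → A) : Prop :=
  ∀ k, IsPrefixInf (f (prefixList t k)) y

/-- Pure epistandard morphisms: finite compositions of the morphisms `ψ_a`. -/
inductive PureEpistandard {A : Type*} [DecidableEq A] : (List A → List A) → Prop
  | id : PureEpistandard _root_.id
  | comp (a : A) (f : List A → List A) : PureEpistandard f →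
      PureEpistandard (fun w => psiW a (f w))

/-- An infinite word is episkew if it is non-recurrent and all of its factors
are finite episturmian. -/
def Episkew {A : Type*} (t : ℕ → A) : Prop :=
  ¬ Recurrent t ∧ ∀ u, IsFactorInf t u → FiniteEpisturmian u

/- Two-letter (Bool) notions: `false` plays the role of `a`, `true` of `b`,
with the order `false < true`. -/

/-- A finite binary word is balanced. -/
def BalancedList (w : List Bool) : Prop :=
  ∀ u v : List Bool, u <:+: w → v <:+: w → u.length = v.length →
    |(u.count true : ℤ) - (v.count true : ℤ)| ≤ 1

/-- An infinite binary word is balanced. -/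
def BalancedInf (t : ℕ → Bool) : Prop :=
  ∀ u v : List Bool, IsFactorInf t u → IsFactorInf t v → u.length = v.length →
    |(u.count true : ℤ) - (v.count true : ℤ)| ≤ 1

/-- The Sturmian word of slope `α` and intercept `ρ` defined via floors. -/
def SturmianFloor (α ρ : ℝ) (t : ℕ → Bool) : Prop :=
  ∀ n : ℕ, t n = true ↔ ⌊((n : ℝ) + 1) * α + ρ⌋ ≠ ⌊(n : ℝ) * α + ρ⌋

/-- The Sturmian word of slope `α` and intercept `ρ` defined via ceilings. -/
def SturmianCeil (α ρ : ℝ) (t : ℕ → Bool) : Prop :=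
  ∀ n : ℕ, t n = true ↔ ⌈((n : ℝ) + 1) * α + ρ⌉ ≠ ⌈(n : ℝ) * α + ρ⌉

/-- Aperiodic Sturmian words: those of irrational slope. -/
def IsAperiodicSturmian (t : ℕ → Bool) : Prop :=
  ∃ α ρ : ℝ, α ∈ Set.Icc (0 : ℝ) 1 ∧ ρ ∈ Set.Icc (0 : ℝ) 1 ∧ Irrational α ∧
    (SturmianFloor α ρ t ∨ SturmianCeil α ρ t)

/-- Standard Sturmian words: those with `ρ = α`. -/
def IsStandardSturmian (t : ℕ → Bool) : Prop :=
  ∃ α : ℝ, α ∈ Set.Icc (0 : ℝ) 1 ∧ (SturmianFloor α α t ∨ SturmianCeil α α t)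

/-- A fine infinite binary word: `(min(t), max(t)) = (a·s, b·s)` for some infinite word `s`. -/
def FineBool (t : ℕ → Bool) : Prop :=
  ∃ s : ℕ → Bool, IsMinInf (· < ·) t (consInf false s) ∧ IsMaxInf (· < ·) t (consInf true s)

/-- A periodic infinite word. -/
def PeriodicInf {A : Type*} (t : ℕ → A) : Prop := ∃ p, 0 < p ∧ ∀ i, t (i + p) = t i

/-- An ultimately periodic infinite word. -/
def UltPeriodicInf {A : Type*} (t : ℕ → A) : Prop :=
  ∃ p, 0 < p ∧ ∃ m, ∀ i, m ≤ i → t (i + p) = t i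

namespace EpiLex

variable {A : Type*}

/-- The prefix of length `n` of `s` occurs at position `i`. -/
def Occ (s : ℕ → A) (n i : ℕ) : Prop := ∀ j, j < n → s (i + j) = s j

/-- The block of length `L` at position `i` is a palindrome. -/
def Pal (s : ℕ → A) (i L : ℕ) : Prop := ∀ j k, j + k + 1 = L → s (i + j) = s (i + k)

/-- `i < j` are consecutive occurrences of the prefix of length `n`. -/
def Nxt (s : ℕ → A) (n i j : ℕ) : Prop :=
  i < j ∧ Occ s n i ∧ Occ s n j ∧ ∀ k, i < k → k < j → ¬ Occ s n k

/-- The key combinatorial condition at length `n`. -/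
def Star (s : ℕ → A) (n : ℕ) : Prop :=
  ∀ i, Occ s n (i + 1) → s (i + 1 + n) = s n ∨ s i = s n

/-- The inductive invariant for palindromic prefixes. -/
structure Good (s : ℕ → A) (n : ℕ) : Prop where
  pal : Pal s 0 n
  inf : ∀ N, ∃ i, N ≤ i ∧ Occ s n i
  ret : ∀ i j, Nxt s n i j → Pal s i (j - i + n)
  det : ∀ i j i' j', Nxt s n i j → Nxt s n i' j' → s (i + n) = s (i' + n) →
    j - i = j' - i' ∧ ∀ t, t < j - i + n → s (i + t) = s (i' + t)

theorem occ_zero (s : ℕ → A) (n : ℕ) : Occ s n 0 := fun j _ => by simp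

theorem Good.next {s : ℕ → A} {n : ℕ} (h : Good s n) {i : ℕ} (hi : Occ s n i) :
    ∃ j, Nxt s n i j := by
  classical
  have hex : ∃ j, i < j ∧ Occ s n j := by
    obtain ⟨j, h1, h2⟩ := h.inf (i + 1)
    exact ⟨j, by omega, h2⟩
  refine ⟨Nat.find hex, (Nat.find_spec hex).1, hi, (Nat.find_spec hex).2, ?_⟩
  intro k h1 h2 h3
  exact Nat.find_min hex h2 ⟨h1, h3⟩

theorem good_zero (s : ℕ → A) : Good s 0 := by
  have hn : ∀ i j, Nxt s 0 i j → j = i + 1 := by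
    intro i j ⟨h1, _, _, h4⟩
    by_contra hne
    exact h4 (i + 1) (by omega) (by omega) (fun t ht => by omega)
  refine ⟨fun j k h => by omega, fun N => ⟨N, le_rfl, fun t ht => by omega⟩, ?_, ?_⟩
  · intro i j h a b hab
    have := hn i j h
    have ha : a = 0 := by omega
    have hb : b = 0 := by omega
    rw [ha, hb]
  · intro i j i' j' h h' he
    have h1 := hn i j h
    have h2 := hn i' j' h'
    refine ⟨by omega, fun t ht => ?_⟩
    have : t = 0 := by omega
    subst this
    exact he

theorem Good.star_ret {s : ℕ → A} {n : ℕ} (h : Good s n) (hs : Star s n) {i j : ℕ}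
    (hij : Nxt s n i j) : s (i + n) = s n ∨ s (j + n) = s n := by
  have hlt := hij.1
  have h1 := hs (j - 1) (by rw [Nat.sub_add_cancel (by omega)]; exact hij.2.2.1)
  rw [Nat.sub_add_cancel (by omega)] at h1
  rcases h1 with h1 | h1
  · exact Or.inr h1
  · left
    have h2 := h.ret i j hij (j - 1 - i) n (by omega)
    rw [show i + (j - 1 - i) = j - 1 by omega] at h2
    rw [← h2, h1]

theorem Good.occ_big {s : ℕ → A} {n p : ℕ} (h : Good s n) (hp : Nxt s n 0 p) {i : ℕ}
    (hi : Occ s n i) (hx : s (i + n) = s n) : Occ s (p + n) i ∧ Nxt s n i (i + p) := by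
  obtain ⟨j, hj⟩ := h.next hi
  have h1 := hj.1
  obtain ⟨h2, h3⟩ := h.det i j 0 p hj hp (by simpa using hx)
  have h4 : j = i + p := by omega
  subst h4
  refine ⟨fun t ht => ?_, hj⟩
  have := h3 t (by omega)
  simpa using this

theorem occ_small {s : ℕ → A} {n p i : ℕ} (hp : 0 < p) (h : Occ s (p + n) i) :
    Occ s n i ∧ s (i + n) = s n :=
  ⟨fun j hj => h j (by omega), h n (by omega)⟩

/-- Description of consecutive occurrences of the next palindromic prefix. -/
theorem Good.nxt_big {s : ℕ → A} {n p : ℕ} (h : Good s n) (hs : Star s n) (hp : Nxt s n 0 p)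
    {i j : ℕ} (hij : Nxt s (p + n) i j) :
    (s (i + p + n) = s n ∧ j = i + p) ∨ (s (i + p + n) ≠ s n ∧ Nxt s n (i + p) j) := by
  have hp0 := hp.1
  obtain ⟨hlt, hi, hj, hno⟩ := hij
  obtain ⟨hi1, hi2⟩ := occ_small hp0 hi
  obtain ⟨hj1, hj2⟩ := occ_small hp0 hj
  obtain ⟨_, hk⟩ := h.occ_big hp hi1 hi2
  have hjk : i + p ≤ j := by
    by_contra hc
    exact hk.2.2.2 j hlt (by omega) hj1
  by_cases hx : s (i + p + n) = s n
  · left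
    refine ⟨hx, ?_⟩
    obtain ⟨h1, _⟩ := h.occ_big hp hk.2.2.1 hx
    by_contra hne
    exact hno (i + p) (by omega) (by omega) h1
  · right
    refine ⟨hx, ?_⟩
    obtain ⟨l, hl⟩ := h.next hk.2.2.1
    have hl1 := hl.1
    have hlx : s (l + n) = s n := (h.star_ret hs hl).resolve_left hx
    obtain ⟨h1, _⟩ := h.occ_big hp hl.2.2.1 hlx
    have hne : j ≠ i + p := by
      rintro rfl
      exact hx hj2
    have h2 : ¬ j < l := fun hc => hl.2.2.2 j (by omega) hc hj1
    have h3 : ¬ l < j := fun hc => hno l (by omega) hc h1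
    have h4 : l = j := by omega
    exact h4 ▸ hl

theorem Good.step {s : ℕ → A} {n p : ℕ} (h : Good s n) (hs : Star s n) (hp : Nxt s n 0 p) :
    Good s (p + n) := by
  have hp0 := hp.1
  have hpal : Pal s 0 (p + n) := by
    have := h.ret 0 p hp
    simpa using this
  have hpal' : ∀ a b, a + b + 1 = p + n → s a = s b := by
    intro a b hab
    have := hpal a b hab
    simpa using this
  refine ⟨hpal, ?_, ?_, ?_⟩
  · intro N
    obtain ⟨i, hi, ho⟩ := h.inf N
    obtain ⟨j, hj⟩ := h.next ho
    have := hj.1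
    rcases h.star_ret hs hj with hx | hx
    · exact ⟨i, hi, (h.occ_big hp ho hx).1⟩
    · exact ⟨j, by omega, (h.occ_big hp hj.2.2.1 hx).1⟩
  · intro i j hij
    have hlt := hij.1
    have hi := hij.2.1
    have hj := hij.2.2.1
    -- the outer parts
    have key : ∀ a b, a + b + 1 = j - i + (p + n) → a < p + n → s (i + a) = s (i + b) := by
      intro a b hab ha
      have h1 := hi a ha
      have h2 := hj (b - (j - i)) (by omega)
      rw [show j + (b - (j - i)) = i + b by omega] at h2
      rw [h1, h2]
      exact hpal' _ _ (by omega)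
    intro a b hab
    by_cases ha : a < p + n
    · exact key a b hab ha
    by_cases hb : b < p + n
    · exact (key b a (by omega) hb).symm
    rcases h.nxt_big hs hp hij with ⟨_, h2⟩ | ⟨_, h2⟩
    · omega
    · have h3 := h.ret _ _ h2 (a - p) (b - p) (by have := h2.1; omega)
      rw [show i + p + (a - p) = i + a by omega, show i + p + (b - p) = i + b by omega] at h3
      exact h3
  · intro i j i' j' hij hij' he
    have hi := hij.2.1
    have hj := hij.2.2.1
    have hi' := hij'.2.1
    have hj' := hij'.2.2.1
    have e1 : i + (p + n) = i + p + n := by omega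
    have e2 : i' + (p + n) = i' + p + n := by omega
    rw [e1, e2] at he
    have fin : j - i = j' - i' → (∀ t, p ≤ t → t < j - i → s (i + t) = s (i' + t)) →
        j - i = j' - i' ∧ ∀ t, t < j - i + (p + n) → s (i + t) = s (i' + t) := by
      intro hd hm
      refine ⟨hd, fun t ht => ?_⟩
      have h1 := hij.1
      have h2 := hij'.1
      by_cases c1 : t < p
      · rw [hi t (by omega), hi' t (by omega)]
      by_cases c2 : t < j - i
      · exact hm t (by omega) c2
      · have q1 := hj (t - (j - i)) (by omega)
        have q2 := hj' (t - (j - i)) (by omega)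
        rw [show j + (t - (j - i)) = i + t by omega] at q1
        rw [show j' + (t - (j - i)) = i' + t by omega] at q2
        rw [q1, q2]
    rcases h.nxt_big hs hp hij with ⟨h1, h2⟩ | ⟨h1, h2⟩ <;>
      rcases h.nxt_big hs hp hij' with ⟨h1', h2'⟩ | ⟨h1', h2'⟩
    · exact fin (by omega) (fun t h3 h4 => by omega)
    · exact absurd (he ▸ h1) h1'
    · exact absurd (he.symm ▸ h1') h1
    · obtain ⟨q1, q2⟩ := h.det _ _ _ _ h2 h2' he
      have l1 := h2.1
      have l2 := h2'.1
      refine fin (by omega) (fun t h3 h4 => ?_)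
      have := q2 (t - p) (by omega)
      rw [show i + p + (t - p) = i + t by omega, show i' + p + (t - p) = i' + t by omega] at this
      exact this

theorem chain {s : ℕ → A} (hs : ∀ n, Good s n → Star s n) (n : ℕ) :
    ∃ m p, m ≤ n ∧ Good s m ∧ Nxt s m 0 p ∧ n < p + m := by
  induction n with
  | zero =>
    obtain ⟨p, hp⟩ := (good_zero s).next (occ_zero s 0)
    exact ⟨0, p, le_rfl, good_zero s, hp, by have := hp.1; omega⟩
  | succ n ih =>
    obtain ⟨m, p, h1, h2, h3, h4⟩ := ih
    by_cases hc : n + 1 < p + m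
    · exact ⟨m, p, by omega, h2, h3, hc⟩
    · have hg := h2.step (hs m h2) h3
      obtain ⟨q, hq⟩ := hg.next (occ_zero s _)
      have := hq.1
      exact ⟨p + m, q, by omega, hg, hq, by omega⟩

/-- Functional form of closure under reversal. -/
def Rev (s : ℕ → A) : Prop :=
  ∀ i k, ∃ i', ∀ t u, t + u + 1 = k → s (i' + t) = s (i + u)

/-- Functional form of: left special factors are prefixes. -/
def LSp (s : ℕ → A) : Prop :=
  ∀ i i' k, (∀ j, j < k → s (i + 1 + j) = s (i' + 1 + j)) → s i ≠ s i' → Occ s k (i + 1)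

theorem rev_of_star {s : ℕ → A} (hs : ∀ n, Star s n) : Rev s := by
  intro i k
  obtain ⟨m, p, h1, h2, h3, h4⟩ := chain (fun n _ => hs n) (i + k)
  have hg := (h2.step (hs m) h3).pal
  refine ⟨p + m - i - k, fun t u htu => ?_⟩
  have := hg (p + m - i - k + t) (i + u) (by omega)
  simpa using this

theorem lsp_of_star {s : ℕ → A} (hs : ∀ n, Star s n) : LSp s := by
  intro i i' k h hne
  have key : ∀ n, n ≤ k → Occ s n (i + 1) := by
    intro n
    induction n with
    | zero => exact fun _ j hj => by omega
    | succ n ih =>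
      intro hn
      have ho := ih (by omega)
      have ho' : Occ s n (i' + 1) := fun j hj => by rw [← h j (by omega), ho j hj]
      have hl : s (i + 1 + n) = s n := by
        rcases hs n i ho with c | c
        · exact c
        · rcases hs n i' ho' with c' | c'
          · rw [h n (by omega), c']
          · exact absurd (c.trans c'.symm) hne
      intro j hj
      by_cases hjn : j < n
      · exact ho j hjn
      · have : j = n := by omega
        rw [this, hl]
  exact key k le_rfl

theorem recur {s : ℕ → A} (hr : Rev s) (i k N : ℕ) :
    ∃ i', N ≤ i' ∧ ∀ t, t < k → s (i' + t) = s (i + t) := by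
  obtain ⟨q, hq⟩ := hr i k
  obtain ⟨q', hq'⟩ := hr 0 (q + k + N)
  refine ⟨q' + N, by omega, fun t ht => ?_⟩
  have h1 := hq' (N + t) (q + (k - 1 - t)) (by omega)
  have h2 := hq (k - 1 - t) t (by omega)
  rw [show q' + N + t = q' + (N + t) by omega, h1, ← h2, zero_add]

theorem star_of_good {s : ℕ → A} (hr : Rev s) (hl : LSp s) {n : ℕ} (h : Good s n) :
    Star s n := by
  intro i hi
  by_contra hc
  push Not at hc
  obtain ⟨hy, ha⟩ := hc
  -- no later occurrence is followed by the letter `s n`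
  have key : ∀ l, i + 1 ≤ l → Occ s n l → s (l + n) ≠ s n ∧ s (l - 1) ≠ s n := by
    intro l
    induction l using Nat.strong_induction_on with
    | _ l ih =>
      intro hl1 hol
      by_cases he : l = i + 1
      · subst he
        exact ⟨hy, by simpa using ha⟩
      · -- previous occurrence
        classical
        have hpr : ∃ k, i + 1 ≤ k ∧ Nxt s n k l := by
          have hP : ∃ k, i + 1 ≤ k ∧ k < l ∧ Occ s n k := ⟨i + 1, le_rfl, by omega, hi⟩
          obtain ⟨k0, hk0⟩ := hP
          let P : ℕ → Prop := fun k => i + 1 ≤ k ∧ k < l ∧ Occ s n k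
          have hg : P (Nat.findGreatest P l) :=
            Nat.findGreatest_spec (P := P) (m := k0) (by omega) hk0
          refine ⟨_, hg.1, hg.2.1, hg.2.2, hol, ?_⟩
          intro k h1 h2 h3
          have : P k := ⟨by have := hg.1; omega, h2, h3⟩
          have := Nat.le_findGreatest (P := P) (n := l) (by omega) this
          omega
        obtain ⟨k, hk1, hk⟩ := hpr
        have hkl := hk.1
        obtain ⟨q1, q2⟩ := ih k hkl hk1 hk.2.1
        have hp := h.ret k l hk (l - 1 - k) n (by omega)
        rw [show k + (l - 1 - k) = l - 1 by omega] at hp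
        refine ⟨?_, by rw [hp]; exact q1⟩
        -- reversal of the block at l - 1 of length n + 2
        obtain ⟨r, hrr⟩ := hr (l - 1) (n + 2)
        have f1 : s r = s (l + n) := by
          have := hrr 0 (n + 1) (by omega)
          rw [show l - 1 + (n + 1) = l + n by omega] at this
          simpa using this
        have f2 : s (r + (n + 1)) = s (k + n) := by
          have := hrr (n + 1) 0 (by omega)
          rw [this, add_zero, hp]
        have f3 : ∀ t, t < n → s (r + 1 + t) = s t := by
          intro t ht
          have g1 := hrr (t + 1) (n - t) (by omega)
          have g2 := hol (n - 1 - t) (by omega)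
          have g3 := h.pal (n - 1 - t) t (by omega)
          rw [show r + 1 + t = r + (t + 1) by omega, g1,
            show l - 1 + (n - t) = l + (n - 1 - t) by omega, g2]
          simpa using g3
        intro hx
        have hne : s r ≠ s (k - 1) := by
          rw [f1, hx]
          exact fun e => q2 e.symm
        have := hl r (k - 1) (n + 1) (by
          intro j hj
          rw [show k - 1 + 1 + j = k + j by omega]
          by_cases hjn : j < n
          · rw [f3 j hjn, hk.2.1 j hjn]
          · have e : j = n := by omega
            subst e
            rw [← f2]
            congr 1
            omega) hne n (by omega)
        rw [show r + 1 + n = r + (n + 1) by omega, f2] at this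
        exact q1 this
  obtain ⟨l, h1, h2⟩ := recur hr 0 (n + 1) (i + 1)
  refine (key l h1 (fun j hj => by simpa using h2 j (by omega))).1 ?_
  simpa using h2 n (by omega)

theorem star_of_rev {s : ℕ → A} (hr : Rev s) (hl : LSp s) (n : ℕ) : Star s n := by
  intro i hi
  by_contra hc
  have hc' := hc
  push Not at hc
  obtain ⟨hy, ha⟩ := hc
  obtain ⟨m, p, h1, h2, h3, h4⟩ := chain (fun n h => star_of_good hr hl h) n
  -- the prefix of length n is a palindrome
  have hpal : Pal s 0 n := by
    obtain ⟨q, hq⟩ := hr 0 (n + 1)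
    obtain ⟨q', hq'⟩ := hr (i + 1) (n + 1)
    have e1 : s q = s n := by simpa using hq 0 n (by omega)
    have e2 : s q' = s (i + 1 + n) := by simpa using hq' 0 n (by omega)
    have ho := hl q q' n (by
      intro j hj
      have g1 := hq (1 + j) (n - 1 - j) (by omega)
      have g2 := hq' (1 + j) (n - 1 - j) (by omega)
      have g3 := hi (n - 1 - j) (by omega)
      rw [← add_assoc] at g1 g2
      rw [g1, g2, g3, zero_add]) (by rw [e1, e2]; exact fun e => hy e.symm)
    intro a b hab
    have g1 := hq (1 + a) b (by omega)
    have g2 := ho a (by omega)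
    rw [← add_assoc, g2] at g1
    rw [zero_add, g1]
  have hocc : Occ s m (n - m) := by
    intro j hj
    have g1 := hpal (n - m + j) (m - 1 - j) (by omega)
    have g2 := h2.pal (m - 1 - j) j (by omega)
    rw [g2] at g1
    simpa using g1
  have : m = n := by
    by_contra hne
    exact h3.2.2.2 (n - m) (by omega) (by omega) hocc
  subst this
  exact hc' (star_of_good hr hl h2 i hi)

/-! ### Translation to lists -/

theorem map_range_eq {g h : ℕ → A} {k : ℕ} :
    (List.range k).map g = (List.range k).map h ↔ ∀ j, j < k → g j = h j := by
  simp [List.map_inj_left]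

theorem isFactor_map {s g : ℕ → A} {k : ℕ} :
    IsFactorInf s ((List.range k).map g) ↔ ∃ i, ∀ j, j < k → s (i + j) = g j := by
  unfold IsFactorInf FactorAt
  simp only [List.length_map, List.length_range, map_range_eq]
  exact exists_congr fun i => forall₂_congr fun j _ => eq_comm

theorem isFactor_seg (s : ℕ → A) (i k : ℕ) :
    IsFactorInf s ((List.range k).map (fun j => s (i + j))) :=
  isFactor_map.2 ⟨i, fun _ _ => rfl⟩

theorem reverse_map (g : ℕ → A) (k : ℕ) :
    ((List.range k).map g).reverse = (List.range k).map (fun j => g (k - 1 - j)) := by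
  apply List.ext_getElem
  · simp
  · intro n h1 h2
    simp

theorem cons_seg (s : ℕ → A) (i k : ℕ) :
    s i :: (List.range k).map (fun j => s (i + 1 + j)) =
      (List.range (k + 1)).map (fun j => s (i + j)) := by
  rw [List.range_succ_eq_map]
  simp [Function.comp_def, add_assoc, add_comm 1]

theorem rev_iff (s : ℕ → A) :
    (∀ u, IsFactorInf s u → IsFactorInf s u.reverse) ↔ Rev s := by
  constructor
  · intro h i k
    have := h _ (isFactor_seg s i k)
    rw [reverse_map, isFactor_map] at this
    obtain ⟨i', hi'⟩ := this
    refine ⟨i', fun t u htu => ?_⟩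
    rw [hi' t (by omega)]
    congr 2
    omega
  · rintro h u ⟨i, hi⟩
    obtain ⟨i', hi'⟩ := h i u.length
    unfold FactorAt at hi
    rw [hi, reverse_map, isFactor_map]
    exact ⟨i', fun j hj => hi' _ _ (by omega)⟩

theorem lsp_iff (s : ℕ → A) :
    (∀ u, LeftSpecial s u → u = prefixList s u.length) ↔ LSp s := by
  constructor
  · intro h i i' k he hne
    have := h ((List.range k).map (fun j => s (i + 1 + j))) ⟨s i, s i', hne, by
      rw [cons_seg]; exact isFactor_seg s i (k + 1), by
      rw [map_range_eq.2 he, cons_seg]; exact isFactor_seg s i' (k + 1)⟩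
    unfold prefixList at this
    rw [List.length_map, List.length_range, map_range_eq] at this
    exact this
  · rintro h u ⟨a, b, hab, ⟨i, hi⟩, ⟨i', hi'⟩⟩
    unfold FactorAt at hi hi'
    rw [List.length_cons, ← cons_seg] at hi hi'
    injection hi with p1 p2
    injection hi' with p3 p4
    have he := map_range_eq.1 (p2.symm.trans p4)
    have := h i i' u.length he (by rw [← p1, ← p3]; exact hab)
    unfold prefixList
    exact p2.trans (map_range_eq.2 this)

theorem std_iff (s : ℕ → A) : StdEpisturmian s ↔ ∀ n, Star s n := by
  constructor
  · rintro ⟨⟨h1, _⟩, h2⟩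
    exact star_of_rev ((rev_iff s).1 h1) ((lsp_iff s).1 h2)
  · intro h
    have h1 := (rev_iff s).2 (rev_of_star h)
    have h2 := (lsp_iff s).2 (lsp_of_star h)
    have h3 : ∀ u, RightSpecial s u → LeftSpecial s u.reverse := by
      rintro u ⟨a, b, hab, ha, hb⟩
      exact ⟨a, b, hab, by simpa using h1 _ ha, by simpa using h1 _ hb⟩
    refine ⟨⟨h1, fun u v hu hv hl => ?_⟩, h2⟩
    have e1 := h2 _ (h3 u hu)
    have e2 := h2 _ (h3 v hv)
    rw [List.length_reverse] at e1 e2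
    rw [hl, ← e2] at e1
    exact List.reverse_injective e1

theorem lex_cons_cons' {r : A → A → Prop} {a b : A} {u v : List A} :
    List.Lex r (a :: u) (b :: v) ↔ r a b ∨ a = b ∧ List.Lex r u v := by
  constructor
  · intro h
    cases h with
    | rel h => exact Or.inl h
    | cons h => exact Or.inr ⟨rfl, h⟩
  · rintro (h | ⟨rfl, h⟩)
    · exact List.Lex.rel h
    · exact List.Lex.cons h

theorem lex_map {r : A → A → Prop} (k : ℕ) : ∀ g h : ℕ → A,
    List.Lex r ((List.range k).map g) ((List.range k).map h) ↔
      ∃ j, j < k ∧ (∀ t, t < j → g t = h t) ∧ r (g j) (h j) := by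
  induction k with
  | zero =>
    intro g h
    simp
  | succ k ih =>
    intro g h
    rw [List.range_succ_eq_map, List.map_cons, List.map_cons, List.map_map, List.map_map]
    rw [lex_cons_cons', ih]
    constructor
    · rintro (hr | ⟨h0, j, hj, h1, h2⟩)
      · exact ⟨0, by omega, fun t ht => by omega, hr⟩
      · refine ⟨j + 1, by omega, fun t ht => ?_, h2⟩
        cases t with
        | zero => exact h0
        | succ t => exact h1 t (by omega)
    · rintro ⟨j, hj, h1, h2⟩
      cases j with
      | zero => exact Or.inl h2
      | succ j =>
        exact Or.inr ⟨h1 0 (by omega), j, by omega, fun t ht => h1 (t + 1) (by omega), h2⟩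

theorem star_lex {s : ℕ → A} (hs : ∀ n, Star s n) (r : A → A → Prop) (a : A)
    (hra : AcceptablePair r a) (m : ℕ → A) (hm : IsMinInf r s m) : infLe r (consInf a s) m := by
  classical
  by_cases he : consInf a s = m
  · exact Or.inl he
  right
  have hex : ∃ i, consInf a s i ≠ m i := by
    by_contra hc
    push Not at hc
    exact he (funext hc)
  refine ⟨Nat.find hex, fun j hj => not_not.1 (Nat.find_min hex hj), ?_⟩
  have hne := Nat.find_spec hex
  have hmin : ∀ j, j < Nat.find hex → consInf a s j = m j :=
    fun j hj => not_not.1 (Nat.find_min hex hj)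
  generalize Nat.find hex = i at hne hmin
  cases i with
  | zero => exact hra.2 _ (fun e => hne e.symm)
  | succ k =>
    obtain ⟨q, hq⟩ := isFactor_map.1 (hm (k + 2)).1
    have h0 : s q = a := by
      have := hq 0 (by omega)
      rw [← hmin 0 (by omega)] at this
      simpa [consInf] using this
    have hl : s (q + 1 + k) = m (k + 1) := by
      rw [← hq (k + 1) (by omega)]
      congr 1
      omega
    have ho : Occ s k (q + 1) := by
      intro j hj
      have := hq (j + 1) (by omega)
      rw [← hmin (j + 1) (by omega)] at this
      rw [show q + 1 + j = q + (j + 1) by omega, this]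
      rfl
    have hne' : s k ≠ m (k + 1) := hne
    rcases hs k q ho with c | c
    · exact absurd (c.symm.trans hl) hne'
    · have : s k = a := c.symm.trans h0
      change r (s k) (m (k + 1))
      rw [this]
      exact hra.2 _ (fun e => hne' (this.trans e.symm))

/-- Positions whose factor of length `k` is minimal for the order induced by `f`. -/
def minPos (f : A → ℕ) (s : ℕ → A) : ℕ → Set ℕ
  | 0 => Set.univ
  | k + 1 => {q | q ∈ minPos f s k ∧ ∀ q' ∈ minPos f s k, f (s (q + k)) ≤ f (s (q' + k))}

theorem minPos_nonempty (f : A → ℕ) (s : ℕ → A) (k : ℕ) : (minPos f s k).Nonempty := by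
  induction k with
  | zero => exact ⟨0, trivial⟩
  | succ k ih =>
    have := ih
    obtain ⟨q, hq, hmin⟩ := (measure (fun q => f (s (q + k)))).wf.has_min _ ih
    exact ⟨q, hq, fun q' hq' => not_lt.1 (hmin q' hq')⟩

theorem exists_min (f : A → ℕ) (hf : Function.Injective f) (s : ℕ → A) :
    ∃ m, IsMinInf (fun x y => f x < f y) s m := by
  choose q hq using minPos_nonempty f s
  let m : ℕ → A := fun k => s (q (k + 1) + k)
  have hm : ∀ k i, i ∈ minPos f s (k + 1) → s (i + k) = m k := by
    intro k i hi
    apply hf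
    exact le_antisymm (hi.2 _ (hq (k + 1)).1) ((hq (k + 1)).2 _ hi.1)
  have hpre : ∀ k i, i ∈ minPos f s k → ∀ j, j < k → s (i + j) = m j := by
    intro k
    induction k with
    | zero => exact fun i _ j hj => by omega
    | succ k ih =>
      intro i hi j hj
      by_cases h : j < k
      · exact ih i hi.1 j h
      · have : j = k := by omega
        subst this
        exact hm j i hi
  have hall : ∀ k i, i ∈ minPos f s k ∨
      ∃ j, j < k ∧ (∀ t, t < j → m t = s (i + t)) ∧ f (m j) < f (s (i + j)) := by
    intro k i
    induction k with
    | zero => exact Or.inl trivial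
    | succ k ih =>
      rcases ih with h | ⟨j, h1, h2⟩
      · by_cases hc : f (s (i + k)) ≤ f (m k)
        · left
          exact ⟨h, fun q' hq' => hc.trans ((hq (k + 1)).2 _ hq')⟩
        · right
          exact ⟨k, by omega, fun t ht => (hpre k i h t ht).symm, not_le.1 hc⟩
      · exact Or.inr ⟨j, by omega, h2⟩
  refine ⟨m, fun k => ⟨isFactor_map.2 ⟨q k, hpre k _ (hq k)⟩, ?_⟩⟩
  rintro u ⟨i, hi⟩ hu
  unfold FactorAt at hi
  rw [hu] at hi
  rw [hi]
  rcases hall k i with h | h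
  · left
    exact map_range_eq.2 fun j hj => (hpre k i h j hj).symm
  · right
    exact (lex_map k _ _).2 h

theorem star_of_lex [Fintype A] {s : ℕ → A}
    (h : ∀ (r : A → A → Prop) (a : A), AcceptablePair r a →
        ∀ m : ℕ → A, IsMinInf r s m → infLe r (consInf a s) m) (n : ℕ) : Star s n := by
  classical
  intro i hi
  by_contra hc
  push Not at hc
  obtain ⟨hy, ha⟩ := hc
  let f : A → ℕ := fun z => if z = s i then 0 else if z = s (i + 1 + n) then 1 else
    (Fintype.equivFin A z : ℕ) + 2
  have hf : Function.Injective f := by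
    intro z z' hz
    simp only [f] at hz
    split_ifs at hz
    all_goals first
      | omega
      | (simp_all; done)
      | exact (Fintype.equivFin A).injective (Fin.ext (by omega))
  have hacc : AcceptablePair (fun x y => f x < f y) (s i) := by
    constructor
    · exact
        { trichotomous := fun x y h1 h2 => hf (by omega)
          irrefl := fun x => lt_irrefl _
          trans := fun x y z h1 h2 => lt_trans h1 h2 }
    · intro b hb
      simp only [f, if_true, if_neg hb]
      split_ifs <;> omega
  have hyx : f (s (i + 1 + n)) < f (s n) := by
    simp only [f, if_neg (Ne.symm ha), if_neg (Ne.symm hy), if_true]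
    split_ifs <;> omega
  obtain ⟨m, hm⟩ := exists_min f hf s
  have h1 := h _ _ hacc m hm
  have h2 := (hm (n + 2)).2 _ (isFactor_seg s i (n + 2)) (by simp)
  have hcs : ∀ j, j < n + 1 → s (i + j) = consInf (s i) s j := by
    intro j hj
    cases j with
    | zero => rfl
    | succ j =>
      have := hi j (by omega)
      rw [show i + (j + 1) = i + 1 + j by omega, this]
      rfl
  have hcl : consInf (s i) s (n + 1) = s n := rfl
  have hsl : s (i + (n + 1)) = s (i + 1 + n) := by congr 1; omega
  have h2' : (∀ j, j < n + 2 → m j = s (i + j)) ∨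
      ∃ j, j < n + 2 ∧ (∀ t, t < j → m t = s (i + t)) ∧ f (m j) < f (s (i + j)) := by
    rcases h2 with h2 | h2
    · exact Or.inl (map_range_eq.1 h2)
    · exact Or.inr ((lex_map _ _ _).1 h2)
  -- `m` is strictly below `consInf (s i) s`
  have h3 : ∃ j, (∀ t, t < j → m t = consInf (s i) s t) ∧ f (m j) < f (consInf (s i) s j) := by
    rcases h2' with h2 | ⟨j, hj, h2, h3⟩
    · refine ⟨n + 1, fun t ht => by rw [h2 t (by omega), hcs t ht], ?_⟩
      rw [h2 _ (by omega), hcl, hsl]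
      exact hyx
    · refine ⟨j, fun t ht => by rw [h2 t ht, hcs t (by omega)], ?_⟩
      by_cases hjn : j < n + 1
      · rw [← hcs j hjn]
        exact h3
      · have : j = n + 1 := by omega
        subst this
        rw [hsl] at h3
        rw [hcl]
        exact h3.trans hyx
  obtain ⟨j, h3, h4⟩ := h3
  rcases h1 with h1 | ⟨l, h5, h6⟩
  · rw [h1] at h4
    exact lt_irrefl _ h4
  · rcases lt_trichotomy j l with c | c | c
    · rw [h5 j c] at h4
      exact lt_irrefl _ h4
    · subst c
      exact lt_asymm h4 h6
    · rw [h3 l c] at h6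
      exact lt_irrefl _ h6

end EpiLex

/-- An infinite word `s` over a finite alphabet is standard episturmian iff
`a·s ≤ min(s)` for every acceptable pair `(a, <)`. -/
theorem standard_episturmian_iff_lex {A : Type*} [Fintype A] (s : ℕ → A) :
    StdEpisturmian s ↔
      ∀ (r : A → A → Prop) (a : A), AcceptablePair r a →
        ∀ m : ℕ → A, IsMinInf r s m → infLe r (consInf a s) m := by
  rw [EpiLex.std_iff]
  exact ⟨fun h r a hra m hm => EpiLex.star_lex h r a hra m hm, fun h => EpiLex.star_of_lex h⟩
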